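/- arXiv:1406.5722 — 2 statements merged into one kernel-verified Lean document; each statement's English description precedes it below -/
import Mathlib

section
/- For every integer n ≥ 1, the price of envy-freeness with n agents and n items satisfies p_envy(n,n) ≤ (1/2)·√n + 1/n + 1. -/
open Finset

/-- A utility matrix for `n` agents and `n` items: `x i j` is the (nonnegative)
utility of agent `j` for item `i`, and each agent's utilities sum to `1`. -/
def IsUtilMatrix (n : ℕ) (x : Fin n → Fin n → ℝ) : Prop :=
  (∀ i j, 0 ≤ x i j) ∧ (∀ j, ∑ i, x i j = 1)

/-- `x` is diagonally envy-free: the allocation assigning item `j` to agent `j`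
is envy-free, i.e. `x j j ≥ x i j` for all `i, j`. -/
def DiagEnvyFree (n : ℕ) (x : Fin n → Fin n → ℝ) : Prop :=
  ∀ i j, x j j ≥ x i j

/-- Optimal welfare: each item goes to an agent valuing it the most. -/
noncomputable def uStar (n : ℕ) (x : Fin n → Fin n → ℝ) : ℝ :=
  ∑ i, ⨆ j, x i j

/-- Welfare of the (envy-free) diagonal allocation. -/
noncomputable def uStarF (n : ℕ) (x : Fin n → Fin n → ℝ) : ℝ :=
  ∑ j, x j j

/-- The price of envy-freeness for `n` agents and `n` items: the supremum of
`uStar x / uStarF x` over all diagonally envy-free utility matrices `x`. -/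
noncomputable def pEnvySq (n : ℕ) : ℝ :=
  sSup {r : ℝ | ∃ x : Fin n → Fin n → ℝ,
    IsUtilMatrix n x ∧ DiagEnvyFree n x ∧ r = uStar n x / uStarF n x}

/-- A number that is at most `1` and at most `k * e` is at most any weighted arithmetic mean
`(k / s + s * e) / 2` of `k` and `e`. -/
theorem le_weighted_mean_of_le_mul {v k e s : ℝ} (hs : 0 < s) (hk : 0 ≤ k) (he : 0 ≤ e)
    (hv : v ≤ 1) (hvke : v ≤ k * e) : v ≤ (k / s + s * e) / 2 := by
  have hmean : 0 ≤ (k / s + s * e) / 2 := by positivity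
  rcases le_or_gt v 0 with h | h
  · linarith
  · refine (sq_le_sq₀ h.le hmean).1 ?_
    have hks : k / s * (s * e) = k * e := by field_simp
    nlinarith [sq_nonneg (k / s - s * e)]

theorem IsUtilMatrix.inv_le_diag {n : ℕ} {x : Fin n → Fin n → ℝ} (hx : IsUtilMatrix n x)
    (hd : DiagEnvyFree n x) (hn : 0 < n) (j : Fin n) : 1 / (n : ℝ) ≤ x j j := by
  have h : ∑ i, x i j ≤ ∑ _i : Fin n, x j j := sum_le_sum fun i _ => hd i j
  rw [hx.2 j] at h
  simp only [sum_const, card_univ, Fintype.card_fin, nsmul_eq_mul] at h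
  rw [div_le_iff₀ (by exact_mod_cast hn)]
  linarith

theorem IsUtilMatrix.one_le_uStarF {n : ℕ} {x : Fin n → Fin n → ℝ} (hx : IsUtilMatrix n x)
    (hd : DiagEnvyFree n x) (hn : 0 < n) : 1 ≤ uStarF n x := by
  have hn' : (n : ℝ) ≠ 0 := by exact_mod_cast hn.ne'
  calc (1 : ℝ) = ∑ _j : Fin n, 1 / (n : ℝ) := by simp [hn']
    _ ≤ uStarF n x := sum_le_sum fun j _ => hx.inv_le_diag hd hn j

/-- The utility an agent derives from a set `S` of items, in terms of the size of `S` and the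
excess of the diagonal utility over `1 / n`. -/
theorem IsUtilMatrix.sum_le {n : ℕ} {x : Fin n → Fin n → ℝ} (hx : IsUtilMatrix n x)
    (hd : DiagEnvyFree n x) (hn : 0 < n) (j : Fin n) (S : Finset (Fin n)) :
    ∑ i ∈ S, x i j ≤ #S / (n : ℝ) + (#S / √n + √n * (x j j - 1 / n)) / 2 := by
  have hn' : (0 : ℝ) < n := by exact_mod_cast hn
  have hone : ∑ i ∈ S, x i j ≤ 1 := by
    rw [← hx.2 j]
    exact sum_le_sum_of_subset_of_nonneg (subset_univ S) fun i _ _ => hx.1 i j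
  have hcard : ∑ i ∈ S, x i j ≤ #S * x j j := by
    rw [← nsmul_eq_mul]
    exact sum_le_card_nsmul S _ _ fun i _ => hd i j
  have hk : (0 : ℝ) ≤ #S / (n : ℝ) := by positivity
  have h := le_weighted_mean_of_le_mul (v := ∑ i ∈ S, x i j - #S / (n : ℝ)) (k := (#S : ℝ))
    (e := x j j - 1 / n) (Real.sqrt_pos.2 hn') (by positivity)
    (sub_nonneg.2 (hx.inv_le_diag hd hn j)) (by linarith)
    (by rw [mul_sub, mul_one_div]; linarith)
  linarith

theorem IsUtilMatrix.uStar_le {n : ℕ} {x : Fin n → Fin n → ℝ} (hx : IsUtilMatrix n x)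
    (hd : DiagEnvyFree n x) (hn : 0 < n) :
    uStar n x ≤ 1 + √n / 2 * uStarF n x := by
  have hn' : (0 : ℝ) < n := by exact_mod_cast hn
  have : Nonempty (Fin n) := ⟨⟨0, hn⟩⟩
  choose f hf using fun i => exists_eq_ciSup_of_finite (f := x i)
  have hcard : ∑ j, (#{i | f i = j} : ℝ) = n := by
    rw [← Nat.cast_sum, ← card_eq_sum_card_fiberwise (fun i _ => mem_coe.2 (mem_univ (f i)))]
    simp
  have hs : (n : ℝ) / √n = √n := Real.div_sqrt
  calc uStar n x = ∑ j, ∑ i with f i = j, x i j := by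
        simp only [uStar, ← hf]
        rw [← sum_fiberwise univ f fun i => x i (f i)]
        refine sum_congr rfl fun j _ => sum_congr rfl fun i hi => ?_
        rw [(mem_filter.1 hi).2]
    _ ≤ ∑ j, (#{i | f i = j} / (n : ℝ) +
          (#{i | f i = j} / √n + √n * (x j j - 1 / n)) / 2) :=
        sum_le_sum fun j _ => hx.sum_le hd hn j _
    _ = 1 + √n / 2 * uStarF n x := by
        rw [sum_add_distrib, ← sum_div, ← sum_div, sum_add_distrib, ← sum_div, ← mul_sum,
          sum_sub_distrib, hcard, hs, div_self hn'.ne', uStarF]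
        simp only [sum_const, card_univ, Fintype.card_fin, nsmul_eq_mul,
          mul_one_div_cancel hn'.ne']
        ring

/-- For every integer `n ≥ 1`, the price of envy-freeness with `n` agents and
`n` items satisfies `p_envy(n,n) ≤ (1/2)·√n + 1/n + 1`. -/
theorem pEnvySq_le (n : ℕ) (hn : 1 ≤ n) :
    pEnvySq n ≤ (1 / 2) * Real.sqrt n + 1 / n + 1 := by
  refine Real.sSup_le ?_ (by positivity)
  rintro r ⟨x, hx, hd, rfl⟩
  have hF := hx.one_le_uStarF hd hn
  have hU := hx.uStar_le hd hn
  have hinv : 0 ≤ 1 / (n : ℝ) * uStarF n x := by positivity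
  rw [div_le_iff₀ (by linarith)]
  linarith
end

section
/- The price of envy-freeness p_envy(n,n) equals the maximum, over all pairs of vectors r, s ∈ (ℤ≥0)^n satisfying ∑_{i=1}^n s_i = n, ∑_{i=1}^n r_i = n, and r_i ≤ i·s_i for all 1 ≤ i ≤ n, of the ratio (∑_{i=1}^n r_i/i) / (∑_{i=1}^n s_i/i). -/
open Finset

/-- The values of the integer program, indexed by the classes `i` of agents. -/
def ilpValues (n : ℕ) : Set ℝ :=
  {ρ : ℝ | ∃ r s : Fin n → ℕ,
      (∑ i, s i) = n ∧ (∑ i, r i) = n ∧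
      (∀ i : Fin n, r i ≤ (i.val + 1) * s i) ∧
      ρ = (∑ i : Fin n, (r i : ℝ) / (i.val + 1)) /
          (∑ i : Fin n, (s i : ℝ) / (i.val + 1))}

theorem sum_range_min_sub_mul (b r s : ℕ) :
    ∑ m ∈ range s, min b (r - b * m) = min r (b * s) := by
  induction s with
  | zero => simp
  | succ s ih =>
    rw [sum_range_succ, ih, Nat.mul_succ]
    omega

/-- The integer program indexed by agents: agent `j` has diagonal utility `1 / (c j + 1)` and
receives `k j` items in an optimal allocation. -/
theorem mem_ilpValues_iff {n : ℕ} {ρ : ℝ} :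
    ρ ∈ ilpValues n ↔ ∃ (k : Fin n → ℕ) (c : Fin n → Fin n), ∑ j, k j = n ∧
      (∀ j, k j ≤ (c j).val + 1) ∧
      ρ = (∑ j, (k j : ℝ) / ((c j).val + 1)) / ∑ j, (1 : ℝ) / ((c j).val + 1) := by
  constructor
  · rintro ⟨r, s, hs, hr, hrs, rfl⟩
    have e : Fin n ≃ Σ i : Fin n, Fin (s i) :=
      Fintype.equivOfCardEq (by simp [hs])
    have hk (i : Fin n) :
        ∑ m : Fin (s i), min (i.val + 1) (r i - (i.val + 1) * m.val) = r i := by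
      rw [Fin.sum_univ_eq_sum_range (fun m => min (i.val + 1) (r i - (i.val + 1) * m)),
        sum_range_min_sub_mul, min_eq_left (hrs i)]
    refine ⟨fun j => min ((e j).1.val + 1) (r (e j).1 - ((e j).1.val + 1) * (e j).2.val),
      fun j => (e j).1, ?_, fun j => min_le_left _ _, ?_⟩
    · rw [e.sum_comp (fun p : Σ i : Fin n, Fin (s i) =>
        min (p.1.val + 1) (r p.1 - (p.1.val + 1) * p.2.val)), Fintype.sum_sigma]
      simp only [hk, hr]
    · congr 1
      · rw [e.sum_comp (fun p : Σ i : Fin n, Fin (s i) =>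
          ((min (p.1.val + 1) (r p.1 - (p.1.val + 1) * p.2.val) : ℕ) : ℝ) / (p.1.val + 1)),
          Fintype.sum_sigma]
        refine sum_congr rfl fun i _ => ?_
        rw [← hk i, Nat.cast_sum, sum_div]
      · rw [e.sum_comp (fun p : Σ i : Fin n, Fin (s i) => (1 : ℝ) / (p.1.val + 1)),
          Fintype.sum_sigma]
        simp [div_eq_mul_inv]
  · rintro ⟨k, c, hk, hkc, rfl⟩
    refine ⟨fun i => ∑ j with c j = i, k j, fun i => #{j | c j = i}, ?_, ?_, fun i => ?_, ?_⟩
    · simp only [card_eq_sum_ones, sum_fiberwise]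
      simp
    · rw [sum_fiberwise, hk]
    · rw [mul_comm, ← smul_eq_mul]
      refine sum_le_card_nsmul _ _ _ fun j hj => ?_
      obtain rfl := (mem_filter.mp hj).2
      exact hkc j
    · congr 1
      · rw [← sum_fiberwise univ c]
        refine sum_congr rfl fun i _ => ?_
        rw [Nat.cast_sum, sum_div]
        refine sum_congr rfl fun j hj => ?_
        rw [(mem_filter.mp hj).2]
      · rw [← sum_fiberwise univ c]
        refine sum_congr rfl fun i _ => ?_
        simp only [card_eq_sum_ones, Nat.cast_sum, sum_div]
        refine sum_congr rfl fun j hj => ?_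
        rw [(mem_filter.mp hj).2, Nat.cast_one]

theorem nonneg_of_mem_ilpValues {n : ℕ} {ρ : ℝ} (h : ρ ∈ ilpValues n) : 0 ≤ ρ := by
  obtain ⟨r, s, -, -, -, rfl⟩ := h
  positivity

theorem sum_one_div_pos {n : ℕ} (hn : 1 ≤ n) (c : Fin n → Fin n) :
    0 < ∑ j, (1 : ℝ) / ((c j).val + 1) := by
  have : Nonempty (Fin n) := ⟨⟨0, hn⟩⟩
  exact sum_pos (fun j _ => by positivity) univ_nonempty

theorem bddAbove_ilpValues {n : ℕ} (hn : 1 ≤ n) : BddAbove (ilpValues n) := by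
  refine ⟨n, fun ρ hρ => ?_⟩
  obtain ⟨k, c, hk, -, rfl⟩ := mem_ilpValues_iff.mp hρ
  have hkn (j : Fin n) : k j ≤ n :=
    (single_le_sum (fun _ _ => Nat.zero_le _) (mem_univ j)).trans_eq hk
  rw [div_le_iff₀ (sum_one_div_pos hn c), mul_sum]
  refine sum_le_sum fun j _ => ?_
  rw [mul_one_div]
  gcongr
  exact hkn j

/-- There is an allocation giving `k j` items to each agent `j`, in which every agent who receives
something receives their own item. -/
theorem exists_fiber_card_eq {n : ℕ} (k : Fin n → ℕ) (hk : ∑ j, k j = n) :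
    ∃ a : Fin n → Fin n, (∀ j, #{i | a i = j} = k j) ∧ ∀ j, k j ≠ 0 → a j = j := by
  let t : Finset (Σ _ : Fin n, ℕ) := univ.sigma fun j => range (k j)
  obtain ⟨g, hg⟩ := exists_equiv_extend_of_card_eq (α := Fin n) (t := t)
    (s := {j | k j ≠ 0}) (f := fun j => ⟨j, 0⟩) (by simp [t, card_sigma, hk])
    (by
      intro p hp
      obtain ⟨j, hj, rfl⟩ := mem_image.mp hp
      simpa [t, Nat.pos_iff_ne_zero] using hj)
    (fun i _ j _ h => congrArg Sigma.fst h)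
  refine ⟨fun i => (g i).1.1, fun j => ?_, fun j hj => ?_⟩
  · rw [← card_range (k j)]
    refine card_bij (fun i _ => (g i).1.2) (fun i hi => ?_) (fun i hi i' hi' h => ?_)
      fun m hm => ?_
    · obtain rfl := (mem_filter.mp hi).2
      exact (mem_sigma.mp (g i).2).2
    · refine g.injective (Subtype.ext (Sigma.ext ?_ (heq_of_eq h)))
      exact (mem_filter.mp hi).2.trans (mem_filter.mp hi').2.symm
    · exact ⟨g.symm ⟨⟨j, m⟩, mem_sigma.mpr ⟨mem_univ j, hm⟩⟩, by simp, by simp⟩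
  · simp [hg j (by simpa using hj)]

theorem exists_le_uStar_div_uStarF {n : ℕ} {ρ : ℝ} (h : ρ ∈ ilpValues n) :
    ∃ x : Fin n → Fin n → ℝ,
      IsUtilMatrix n x ∧ DiagEnvyFree n x ∧ ρ ≤ uStar n x / uStarF n x := by
  obtain ⟨k, c, hk, hkc, rfl⟩ := mem_ilpValues_iff.mp h
  obtain ⟨a, ha, haj⟩ := exists_fiber_card_eq k hk
  have hT (j : Fin n) : ∃ T : Finset (Fin n), insert j ({i | a i = j} : Finset (Fin n)) ⊆ T ∧
      #T = (c j).val + 1 := by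
    refine exists_superset_card_eq ?_ (by simp)
    by_cases hj : k j = 0
    · refine (card_insert_le _ _).trans ?_
      rw [ha, hj]
      omega
    · rw [insert_eq_of_mem (by simp [haj j hj]), ha]
      exact hkc j
  choose T hsub hcard using hT
  have hfst (j : Fin n) : j ∈ T j := hsub j (mem_insert_self _ _)
  have hmem (i : Fin n) : i ∈ T (a i) := hsub _ (mem_insert_of_mem (by simp))
  refine ⟨fun i j => if i ∈ T j then 1 / ((c j).val + 1) else 0,
    ⟨fun i j => by positivity, fun j => ?_⟩, fun i j => ?_, ?_⟩
  · rw [sum_ite_mem, univ_inter, sum_const, hcard, nsmul_eq_mul]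
    push_cast
    field_simp
  · simp only [hfst, if_true]
    split_ifs
    · exact le_rfl
    · positivity
  · simp only [uStar, uStarF, hfst, if_true]
    refine div_le_div_of_nonneg_right ?_ (sum_nonneg fun j _ => by positivity)
    calc ∑ j, (k j : ℝ) / ((c j).val + 1)
        = ∑ i, 1 / (((c (a i)).val : ℝ) + 1) := by
          rw [← sum_fiberwise univ a fun i => 1 / (((c (a i)).val : ℝ) + 1)]
          refine sum_congr rfl fun j _ => ?_
          rw [← ha j, card_eq_sum_ones, Nat.cast_sum, sum_div]
          refine sum_congr rfl fun i hi => ?_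
          rw [(mem_filter.mp hi).2, Nat.cast_one]
      _ ≤ _ := by
          refine sum_le_sum fun i _ => ?_
          refine le_trans ?_ (le_ciSup (Set.finite_range _).bddAbove (a i))
          simp [hmem i]

/-- The Lagrangian `v - lam * d` of an agent with diagonal utility `d` receiving `k` items of total
value `v` is maximal at a diagonal utility of the form `1 / (i + 1)`. -/
theorem exists_lagrangian_le {n k : ℕ} (hn : 1 ≤ n) (hkn : k ≤ n) {lam d v : ℝ} (hlam : 0 ≤ lam)
    (hd : 1 ≤ n * d) (hv : v ≤ 1) (hvd : v ≤ k * d) :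
    ∃ i : Fin n, k ≤ i.val + 1 ∧ v - lam * d ≤ (k - lam) / (i.val + 1) := by
  have hn' : (0 : ℝ) < n := by exact_mod_cast hn
  rcases le_or_gt (k : ℝ) lam with h | h
  · refine ⟨⟨n - 1, by omega⟩, by simp only; omega, ?_⟩
    have hcast : ((n - 1 : ℕ) : ℝ) + 1 = n := by exact_mod_cast Nat.sub_add_cancel hn
    simp only [hcast]
    rw [le_div_iff₀ hn']
    nlinarith [mul_le_mul_of_nonneg_left hd (sub_nonneg.mpr h)]
  · have hk' : (0 : ℝ) < k := hlam.trans_lt h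
    have hk : 1 ≤ k := by exact_mod_cast hk'
    refine ⟨⟨k - 1, by omega⟩, by simp only; omega, ?_⟩
    have hcast : ((k - 1 : ℕ) : ℝ) + 1 = k := by exact_mod_cast Nat.sub_add_cancel hk
    simp only [hcast]
    rw [le_div_iff₀ hk']
    rcases le_total 1 (k * d) with hkd | hkd <;> nlinarith

theorem uStar_div_uStarF_le {n : ℕ} (hn : 1 ≤ n) {x : Fin n → Fin n → ℝ}
    (hx : IsUtilMatrix n x) (hdiag : DiagEnvyFree n x) {lam : ℝ} (hlam : 0 ≤ lam)
    (hub : lam ∈ upperBounds (ilpValues n)) : uStar n x / uStarF n x ≤ lam := by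
  have : Nonempty (Fin n) := ⟨⟨0, hn⟩⟩
  choose a ha using fun i => exists_eq_ciSup_of_finite (f := fun j => x i j)
  let k : Fin n → ℕ := fun j => #{i | a i = j}
  have hk : ∑ j, k j = n := by
    simp only [k, card_eq_sum_ones, sum_fiberwise]
    simp
  have hagent (j : Fin n) : ∃ i : Fin n, k j ≤ i.val + 1 ∧
      (∑ i with a i = j, x i j) - lam * x j j ≤ (k j - lam) / (i.val + 1) := by
    refine exists_lagrangian_le hn ((single_le_sum (fun _ _ => Nat.zero_le _) (mem_univ j)).trans_eq hk)
      hlam ?_ ?_ ?_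
    · rw [← hx.2 j]
      simpa using sum_le_card_nsmul univ (fun i => x i j) _ fun i _ => hdiag i j
    · rw [← hx.2 j]
      exact sum_le_sum_of_subset_of_nonneg (filter_subset _ _) fun i _ _ => hx.1 i j
    · simpa [k] using sum_le_card_nsmul {i | a i = j} (fun i => x i j) _ fun i _ => hdiag i j
  choose c hkc hc using hagent
  have hilp := hub (mem_ilpValues_iff.mpr ⟨k, c, hk, hkc, rfl⟩)
  rw [div_le_iff₀ (sum_one_div_pos hn c), mul_sum] at hilp
  have hstar : uStar n x = ∑ j, ∑ i with a i = j, x i j := by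
    rw [uStar, ← sum_fiberwise univ a]
    refine sum_congr rfl fun j _ => sum_congr rfl fun i hi => ?_
    rw [← ha i, (mem_filter.mp hi).2]
  refine div_le_of_le_mul₀ (sum_nonneg fun j _ => hx.1 j j) hlam ?_
  have hsum := sum_le_sum fun j (_ : j ∈ univ) => hc j
  simp only [sum_sub_distrib, sub_div, ← mul_sum] at hsum
  simp only [mul_one_div] at hilp
  rw [hstar, uStarF]
  linarith

/-- The price of envy-freeness `p_envy(n,n)` equals the maximum, over all pairs
of nonnegative integer vectors `r, s` with `∑ s_i = n`, `∑ r_i = n` and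
`r_i ≤ i · s_i` (indices `1 ≤ i ≤ n`), of `(∑ r_i / i) / (∑ s_i / i)`. -/
theorem pEnvySq_eq_ilp (n : ℕ) (hn : 1 ≤ n) :
    pEnvySq n = sSup {ρ : ℝ | ∃ r s : Fin n → ℕ,
      (∑ i, s i) = n ∧ (∑ i, r i) = n ∧
      (∀ i : Fin n, r i ≤ (i.val + 1) * s i) ∧
      ρ = (∑ i : Fin n, (r i : ℝ) / (i.val + 1)) /
          (∑ i : Fin n, (s i : ℝ) / (i.val + 1))} := by
  change sSup _ = sSup (ilpValues n)
  have hlam : 0 ≤ sSup (ilpValues n) := Real.sSup_nonneg fun _ => nonneg_of_mem_ilpValues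
  have hle (ρ : ℝ) (hρ : ∃ x : Fin n → Fin n → ℝ,
      IsUtilMatrix n x ∧ DiagEnvyFree n x ∧ ρ = uStar n x / uStarF n x) :
      ρ ≤ sSup (ilpValues n) := by
    obtain ⟨x, hx, hdiag, rfl⟩ := hρ
    exact uStar_div_uStarF_le hn hx hdiag hlam fun _ => le_csSup (bddAbove_ilpValues hn)
  refine le_antisymm (Real.sSup_le hle hlam) (Real.sSup_le (fun ρ hρ => ?_) ?_)
  · obtain ⟨x, hx, hdiag, h⟩ := exists_le_uStar_div_uStarF hρ
    exact h.trans (le_csSup ⟨_, hle⟩ ⟨x, hx, hdiag, rfl⟩)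
  · refine Real.sSup_nonneg ?_
    rintro _ ⟨x, hx, -, rfl⟩
    exact div_nonneg (sum_nonneg fun i _ => Real.iSup_nonneg fun j => hx.1 i j)
      (sum_nonneg fun j _ => hx.1 j j)
end
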